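/- arXiv:1906.09582 — 2 statements merged into one kernel-verified Lean document; each statement's English description precedes it below -/
import Mathlib

section
/- Let N be a positive integer and let φ be an N×N complex matrix whose minimal polynomial has degree N (a regular matrix). Then the linear map from N×N complex matrices to ℂ^N sending X ↦ (trace(φ^{i}·X))_{i=0,…,N−1} is surjective. -/
/-- Linearly independent matrices give independent trace functionals, by nondegeneracy of the
trace form. -/
theorem LinearIndependent.surjective_trace_mul {K ι m n : Type*} [Field K] [Fintype ι]
    [Fintype m] [Fintype n] {A : ι → Matrix m n K} (hA : LinearIndependent K A) :
    Function.Surjective fun (X : Matrix n m K) (i : ι) => Matrix.trace (A i * X) := by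
  classical
  let T : Matrix n m K →ₗ[K] ι → K :=
    { toFun := fun X i => Matrix.trace (A i * X)
      map_add' := fun X Y => by ext i; simp [Matrix.mul_add]
      map_smul' := fun c X => by ext i; simp }
  suffices hT : LinearMap.range T = ⊤ from LinearMap.range_eq_top.mp hT
  by_contra hT
  obtain ⟨f, hf, hle⟩ := Submodule.exists_le_ker_of_lt_top _ (lt_top_iff_ne_top.mpr hT)
  let c : ι → K := fun i => f fun j => if i = j then 1 else 0
  have hsum : ∑ i, c i • A i = 0 := by
    refine Matrix.ext_iff_trace_mul_right.mpr fun X => ?_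
    have hX : f (T X) = 0 := hle (LinearMap.mem_range_self T X)
    rw [LinearMap.pi_apply_eq_sum_univ] at hX
    simpa [Matrix.sum_mul, Matrix.trace_sum, T, c, mul_comm] using hX
  have hc := Fintype.linearIndependent_iff.mp hA c hsum
  refine hf (LinearMap.ext fun v => ?_)
  rw [LinearMap.pi_apply_eq_sum_univ]
  exact Finset.sum_eq_zero fun i _ => by rw [show f _ = 0 from hc i, smul_zero]


/-- For a regular matrix `φ` (minimal polynomial of degree `N`), the linear map
`X ↦ (trace(φ^i X))_{i=0,…,N−1}` from `N×N` complex matrices to `ℂ^N` is surjective. -/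
theorem surjective_trace_powers_of_regular (N : ℕ) (hN : 0 < N)
    (φ : Matrix (Fin N) (Fin N) ℂ) (hreg : (minpoly ℂ φ).natDegree = N) :
    Function.Surjective
      (fun X : Matrix (Fin N) (Fin N) ℂ =>
        fun i : Fin N => Matrix.trace (φ ^ (i : ℕ) * X)) := by
  have hli : LinearIndependent ℂ fun i : Fin N => φ ^ (i : ℕ) :=
    (linearIndependent_pow φ).comp (Fin.cast hreg.symm) (Fin.cast_injective _)
  exact hli.surjective_trace_mul
end

section
/- Let N be a positive integer and let φ be an N×N complex matrix whose minimal polynomial has degree N (a regular matrix). Then for an N×N complex matrix X, the following are equivalent: (i) trace(φ^{i}·X) = 0 for all i = 0, 1, …, N−1; (ii) there exists an N×N complex matrix Y with X = Y·φ − φ·Y. In other words, the kernel of the map X ↦ (trace(φ^{i}·X))_{i=0,…,N−1} equals the image of ad(φ) : Y ↦ Y·φ − φ·Y. -/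
open Polynomial in
/-- Over an infinite field, some vector has the same annihilating polynomials as `f` itself. -/
theorem Module.End.exists_forall_minpoly_dvd_of_aeval_apply_eq_zero {K V : Type*} [Field K]
    [Infinite K] [AddCommGroup V] [Module K V] [FiniteDimensional K V] (f : Module.End K V) :
    ∃ v : V, ∀ p : K[X], aeval f p v = 0 → minpoly K f ∣ p := by
  classical
  have hm : minpoly K f ≠ 0 := minpoly.ne_zero (Algebra.IsIntegral.isIntegral f)
  let S := (UniqueFactorizationMonoid.normalizedFactors (minpoly K f)).toFinset
  have hS (r : S) : LinearMap.ker (aeval f (minpoly K f / r.1)) ≠ ⊤ := by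
    intro h
    have hr := Multiset.mem_toFinset.1 r.2
    have hirr := UniqueFactorizationMonoid.irreducible_of_normalized_factor _ hr
    obtain ⟨c, hc⟩ := UniqueFactorizationMonoid.dvd_of_mem_normalizedFactors hr
    rw [LinearMap.ker_eq_top, hc, mul_div_cancel_left₀ _ hirr.ne_zero] at h
    have hdvd := minpoly.dvd K f h
    have hc0 : c ≠ 0 := fun h => hm (by rw [hc, h, mul_zero])
    rw [hc, ← one_mul c, ← mul_assoc, mul_one, mul_dvd_mul_iff_right hc0] at hdvd
    exact hirr.not_isUnit (isUnit_of_dvd_one hdvd)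
  obtain ⟨v, hv⟩ := Submodule.exists_forall_notMem_of_forall_ne_top _ hS
  refine ⟨v, fun p hp => ?_⟩
  let g := EuclideanDomain.gcd p (minpoly K f)
  have hg : aeval f g v = 0 := by
    rw [show g = _ from EuclideanDomain.gcd_eq_gcd_ab p (minpoly K f)]
    rw [mul_comm p]
    simp [hp]
  obtain ⟨q, hq⟩ := EuclideanDomain.gcd_dvd_right p (minpoly K f)
  by_cases hu : IsUnit q
  · refine dvd_trans ?_ (EuclideanDomain.gcd_dvd_left p (minpoly K f))
    exact (dvd_of_eq hq).trans (associated_mul_unit_right _ _ hu).symm.dvd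
  · have hq0 : q ≠ 0 := fun h => hm (by rw [hq, h, mul_zero])
    obtain ⟨r, hr, hrq⟩ := WfDvdMonoid.exists_irreducible_factor hu hq0
    obtain ⟨s, hs, hrs⟩ := UniqueFactorizationMonoid.exists_mem_normalizedFactors_of_dvd hm hr
      (hrq.trans ⟨_, hq.trans (mul_comm _ _)⟩)
    obtain ⟨t, ht⟩ := hrs.symm.dvd.trans hrq
    have hs0 : s ≠ 0 := (UniqueFactorizationMonoid.irreducible_of_normalized_factor _ hs).ne_zero
    refine absurd ?_ (hv ⟨s, Multiset.mem_toFinset.2 hs⟩)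
    have hdiv : minpoly K f / s = t * g := by
      rw [show minpoly K f = s * (t * g) by rw [mul_comm t, mul_left_comm, ← ht, ← hq],
        mul_div_cancel_left₀ _ hs0]
    simp [hdiv, hg]

open Polynomial in
/-- If the minimal polynomial of `f` has full degree, then every endomorphism commuting with `f`
is a polynomial in `f` of degree less than the dimension. -/
theorem Module.End.exists_mem_degreeLT_aeval_eq_of_commute {K V : Type*} [Field K]
    [Infinite K] [AddCommGroup V] [Module K V] [FiniteDimensional K V] {f g : Module.End K V}
    (hf : (minpoly K f).natDegree = Module.finrank K V) (hfg : Commute f g) :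
    ∃ p ∈ degreeLT K (Module.finrank K V), aeval f p = g := by
  obtain ⟨v, hv⟩ := f.exists_forall_minpoly_dvd_of_aeval_apply_eq_zero
  let L : degreeLT K (Module.finrank K V) →ₗ[K] V :=
    LinearMap.applyₗ v ∘ₗ (aeval f).toLinearMap ∘ₗ (degreeLT K (Module.finrank K V)).subtype
  have hL : Function.Injective L := by
    refine (injective_iff_map_eq_zero L).2 fun p hp => Subtype.ext ?_
    refine eq_zero_of_dvd_of_degree_lt (hv p.1 hp) ?_
    rw [degree_eq_natDegree (minpoly.ne_zero (Algebra.IsIntegral.isIntegral f)), hf]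
    exact mem_degreeLT.1 p.2
  let e := degreeLTEquiv K (Module.finrank K V)
  have : FiniteDimensional K (degreeLT K (Module.finrank K V)) := .of_injective L hL
  have hsurj : Function.Surjective L :=
    (LinearMap.injective_iff_surjective_of_finrank_eq_finrank
      (by simpa using e.finrank_eq)).1 hL
  obtain ⟨p, hp⟩ := hsurj (g v)
  refine ⟨p.1, p.2, LinearMap.ext fun w => ?_⟩
  obtain ⟨q, rfl⟩ := hsurj w
  have hcomm : Commute (aeval f q.1) g :=
    Algebra.commute_of_mem_adjoin_singleton_of_commute (aeval_mem_adjoin_singleton K f) hfg.symm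
      |>.symm
  calc aeval f p.1 (aeval f q.1 v) = aeval f q.1 (aeval f p.1 v) := by
        rw [← Module.End.mul_apply, ← map_mul, mul_comm, map_mul, Module.End.mul_apply]
    _ = aeval f q.1 (g v) := congrArg _ hp
    _ = g (aeval f q.1 v) := LinearMap.congr_fun hcomm.eq v

/-- Every linear functional on square matrices is represented by the trace pairing. -/
theorem Matrix.exists_trace_mul_eq {n R : Type*} [Fintype n] [CommSemiring R]
    (f : Matrix n n R →ₗ[R] R) : ∃ A : Matrix n n R, ∀ X, f X = (A * X).trace := by
  classical
  refine ⟨Matrix.of fun i j => f (Matrix.single j i 1), fun X => ?_⟩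
  suffices f = Matrix.traceLinearMap n R R ∘ₗ
      LinearMap.mulLeft R (Matrix.of fun i j => f (Matrix.single j i 1)) from
    LinearMap.congr_fun this X
  refine Matrix.ext_linearMap R fun i j => ?_
  ext
  simp [Matrix.trace_mul_single]

/-- For a regular matrix `φ` (minimal polynomial of degree `N`), the kernel of
`X ↦ (trace(φ^i X))_{i=0,…,N−1}` equals the image of `ad(φ) : Y ↦ Yφ − φY`. -/
theorem trace_powers_vanish_iff_mem_ad_image (N : ℕ) (hN : 0 < N)
    (φ X : Matrix (Fin N) (Fin N) ℂ) (hreg : (minpoly ℂ φ).natDegree = N) :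
    (∀ i < N, Matrix.trace (φ ^ i * X) = 0) ↔
      ∃ Y : Matrix (Fin N) (Fin N) ℂ, X = Y * φ - φ * Y := by
  constructor
  · intro h
    let ad : Matrix (Fin N) (Fin N) ℂ →ₗ[ℂ] Matrix (Fin N) (Fin N) ℂ :=
      LinearMap.mulRight ℂ φ - LinearMap.mulLeft ℂ φ
    suffices hX : X ∈ LinearMap.range ad by
      obtain ⟨Y, hY⟩ := hX
      exact ⟨Y, hY.symm⟩
    by_contra hX
    obtain ⟨f, hfX, hf⟩ := Submodule.exists_le_ker_of_notMem hX
    obtain ⟨A, hA⟩ := Matrix.exists_trace_mul_eq f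
    have hcomm : Commute φ A := by
      refine Matrix.ext_iff_trace_mul_right.2 fun Y => ?_
      have hY : f (Y * φ - φ * Y) = 0 := hf ⟨Y, rfl⟩
      rw [hA, mul_sub, Matrix.trace_sub, sub_eq_zero] at hY
      rw [mul_assoc, Matrix.trace_mul_comm, mul_assoc, hY, mul_assoc]
    let e := Matrix.toLinAlgEquiv' (R := ℂ) (n := Fin N)
    obtain ⟨p, hp, hpA⟩ := Module.End.exists_mem_degreeLT_aeval_eq_of_commute
      (f := e φ) (g := e A) (by simpa [minpoly.algEquiv_eq] using hreg) (hcomm.map e)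
    rw [← e.coe_toAlgHom, Polynomial.aeval_algHom_apply] at hpA
    obtain rfl : Polynomial.aeval φ p = A := e.injective hpA
    apply hfX
    have hpN : p.natDegree < N := by
      rw [Polynomial.mem_degreeLT, Module.finrank_fin_fun] at hp
      obtain rfl | hp0 := eq_or_ne p 0
      · simpa using hN
      · exact (Polynomial.natDegree_lt_iff_degree_lt hp0).2 hp
    rw [hA, Polynomial.aeval_eq_sum_range' hpN, Finset.sum_mul, Matrix.trace_sum]
    refine Finset.sum_eq_zero fun i hi => ?_
    rw [smul_mul_assoc, Matrix.trace_smul, h i (Finset.mem_range.1 hi), smul_zero]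
  · rintro ⟨Y, rfl⟩ i -
    rw [mul_sub, Matrix.trace_sub, sub_eq_zero, ← mul_assoc, Matrix.trace_mul_comm, ← mul_assoc,
      ← mul_assoc, ← pow_succ, ← pow_succ']
end
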